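/- Coherence (equality) for the free skew monoidal category: for any categorical derivations f, g : A ⟶ C, f ≐ g if and only if focus(cmplt f) = focus(cmplt g); in particular, equality of maps in Fsk(Var) is decided by comparing focused forms. -/

import Mathlib

set_option linter.unusedVariables false
inductive Fma (V : Type) : Type
  | var : V → Fma V
  | unit : Fma V
  | tens : Fma V → Fma V → Fma V

abbrev Stp (V : Type) := Option (Fma V)

def stpF {V : Type} : Stp V → Fma V
  | none => Fma.unit
  | some A => A

def semF {V : Type} : Fma V → List (Fma V) → Fma V
  | A, [] => A
  | A, B :: Γ => semF (A.tens B) Γ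

abbrev sem {V : Type} (S : Stp V) (Γ : List (Fma V)) : Fma V := semF (stpF S) Γ

theorem semF_append {V : Type} (A : Fma V) (Γ Δ : List (Fma V)) :
    semF A (Γ ++ Δ) = semF (semF A Γ) Δ := by
  induction Γ generalizing A with
  | nil => rfl
  | cons B Γ ih => exact ih _

/-- The categorical calculus: derivations A ⟶ C of the free skew monoidal category. -/
inductive Der {V : Type} : Fma V → Fma V → Type
  | id : Der A A
  | comp : Der B C → Der A B → Der A C
  | tens : Der A C → Der B D → Der (Fma.tens A B) (Fma.tens C D)
  | lam : Der (Fma.tens Fma.unit A) A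
  | rho : Der A (Fma.tens A Fma.unit)
  | alpha : Der (Fma.tens (Fma.tens A B) C) (Fma.tens A (Fma.tens B C))

inductive DerEq {V : Type} : {A C : Fma V} → Der A C → Der A C → Prop
  | refl : DerEq f f
  | symm : DerEq f g → DerEq g f
  | trans : DerEq f g → DerEq g h → DerEq f h
  | compCong : DerEq g g' → DerEq f f' → DerEq (Der.comp g f) (Der.comp g' f')
  | tensCong : DerEq f f' → DerEq g g' → DerEq (Der.tens f g) (Der.tens f' g')
  | compIdL : DerEq (Der.comp Der.id f) f
  | compIdR : DerEq (Der.comp f Der.id) f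
  | compAssoc : DerEq (Der.comp h (Der.comp g f)) (Der.comp (Der.comp h g) f)
  | tensId : DerEq (Der.tens (Der.id (A := A)) (Der.id (A := B))) Der.id
  | tensComp : DerEq (Der.tens (Der.comp g f) (Der.comp k h))
      (Der.comp (Der.tens g k) (Der.tens f h))
  | natLam : DerEq (Der.comp f Der.lam) (Der.comp Der.lam (Der.tens Der.id f))
  | natRho : DerEq (Der.comp Der.rho f) (Der.comp (Der.tens f Der.id) Der.rho)
  | natAlpha : DerEq (Der.comp Der.alpha (Der.tens (Der.tens f g) h))
      (Der.comp (Der.tens f (Der.tens g h)) Der.alpha)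
  | lamRho : DerEq (Der.comp Der.lam Der.rho) (Der.id (A := Fma.unit))
  | skewB : DerEq (Der.comp (Der.tens Der.id Der.lam) (Der.comp Der.alpha (Der.tens Der.rho Der.id)))
      (Der.id (A := Fma.tens A B))
  | skewC : DerEq (Der.comp Der.lam Der.alpha) (Der.tens Der.lam (Der.id (A := B)))
  | skewD : DerEq (Der.comp Der.alpha Der.rho) (Der.tens (Der.id (A := A)) Der.rho)
  | skewE : DerEq
      (Der.comp (Der.tens Der.id Der.alpha) (Der.comp Der.alpha (Der.tens Der.alpha (Der.id (A := D)))))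
      (Der.comp Der.alpha Der.alpha)

/-- The cut-free skew monoidal sequent calculus. -/
inductive CF {V : Type} : Stp V → List (Fma V) → Fma V → Type
  | ax : CF (some A) [] A
  | uf : CF (some A) Γ C → CF none (A :: Γ) C
  | Il : CF none Γ C → CF (some Fma.unit) Γ C
  | Ir : CF none [] Fma.unit
  | tl : CF (some A) (B :: Γ) C → CF (some (Fma.tens A B)) Γ C
  | tr : CF S Γ A → CF none Δ B → CF S (Γ ++ Δ) (Fma.tens A B)

def splitList {α : Type} :
    (Λ₁ Λ₂ Δ₀ Δ₁ : List α) → (A : α) → Λ₁ ++ Λ₂ = Δ₀ ++ A :: Δ₁ →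
      (Σ' Δ₁' : List α, (Λ₁ = Δ₀ ++ A :: Δ₁') ×' (Δ₁ = Δ₁' ++ Λ₂)) ⊕
      (Σ' Δ₀' : List α, (Λ₂ = Δ₀' ++ A :: Δ₁) ×' (Δ₀ = Λ₁ ++ Δ₀'))
  | [], Λ₂, Δ₀, Δ₁, A, h => .inr ⟨Δ₀, h, rfl⟩
  | X :: Λ₁', Λ₂, [], Δ₁, A, h => by
      simp only [List.cons_append, List.nil_append] at h
      injection h with h1 h2
      subst h1
      exact .inl ⟨Λ₁', rfl, h2.symm⟩
  | X :: Λ₁', Λ₂, Y :: Δ₀', Δ₁, A, h => by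
      simp only [List.cons_append] at h
      injection h with h1 h2
      subst h1
      rcases splitList Λ₁' Λ₂ Δ₀' Δ₁ A h2 with ⟨Δ₁', e1, e2⟩ | ⟨Δ₀'', e1, e2⟩
      · exact .inl ⟨Δ₁', by rw [e1]; simp, e2⟩
      · exact .inr ⟨Δ₀'', e1, by rw [e2]; simp⟩

mutual
def scutCF : {V : Type} → {S : Stp V} → {Γ Δ : List (Fma V)} → {A C : Fma V} →
    CF S Γ A → CF (some A) Δ C → CF S (Γ ++ Δ) C
  | _, _, _, _, _, _, .ax, g => g
  | _, _, _, _, _, _, .uf f, g => .uf (scutCF f g)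
  | _, _, _, _, _, _, .Il f, g => .Il (scutCF f g)
  | _, _, _, _, _, _, .tl f, g => .tl (scutCF f g)
  | _, _, _, _, _, _, .Ir, .ax => .Ir
  | _, _, _, _, _, _, .Ir, .Il g => g
  | _, _, _, _, _, _, .Ir, .tr g1 g2 => by
      simp only [List.nil_append]
      exact .tr (scutCF .Ir g1) g2
  | _, _, _, _, _, _, .tr f1 f2, .ax => by
      rw [List.append_nil]; exact .tr f1 f2
  | _, _, _, _, _, _, .tr (Γ := Γ₁) f1 f2, .tl g => ccutCF Γ₁ f2 (scutCF f1 g) rfl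
  | _, _, _, _, _, _, .tr f1 f2, .tr g1 g2 => by
      rw [← List.append_assoc]
      exact .tr (scutCF (.tr f1 f2) g1) g2
  termination_by V S Γ Δ A C f g => (sizeOf A, sizeOf g, sizeOf f)
  decreasing_by
    all_goals subst_vars
    all_goals simp_wf
    all_goals (first
      | (apply Prod.Lex.left; first | omega | (simp; omega))
      | (apply Prod.Lex.right; first
          | (apply Prod.Lex.left; first | omega | (simp; omega))
          | (apply Prod.Lex.right; first | omega | (simp; omega))))

def ccutCF : {V : Type} → {S : Stp V} → {Γ Λ Δ₁ : List (Fma V)} → {A C : Fma V} →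
    (Δ₀ : List (Fma V)) → CF none Γ A → (g : CF S Λ C) → Λ = Δ₀ ++ A :: Δ₁ →
    CF S ((Δ₀ ++ Γ) ++ Δ₁) C
  | _, _, _, _, _, _, _, _, _, .ax, h => by simp at h
  | _, _, _, _, _, _, _, _, _, .Ir, h => by simp at h
  | _, _, _, _, _, _, _, [], f, .uf g, h => by
      simp only [List.nil_append] at h
      injection h with h1 h2
      subst h1; subst h2
      exact scutCF f g
  | _, _, _, _, _, _, _, A'' :: Δ₀', f, .uf g, h => by
      simp only [List.cons_append] at h
      injection h with h1 h2
      subst h1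
      exact .uf (ccutCF Δ₀' f g h2)
  | _, _, _, _, _, _, _, Δ₀, f, .Il g, h => .Il (ccutCF Δ₀ f g h)
  | _, _, _, _, _, _, _, Δ₀, f, .tl (B := B) g, h => .tl (ccutCF (B :: Δ₀) f g (by simp [h]))
  | _, _, _, _, Δ₁, _, _, Δ₀, f, .tr (Γ := Λ₁) (Δ := Λ₂) g1 g2, h => by
      rcases splitList Λ₁ Λ₂ Δ₀ _ _ h with ⟨Δ₁', h1, h2⟩ | ⟨Δ₀', h1, h2⟩
      · subst h2
        have e : ∀ Γ' : List _, (Δ₀ ++ Γ') ++ (Δ₁' ++ Λ₂) = ((Δ₀ ++ Γ') ++ Δ₁') ++ Λ₂ := by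
          intro Γ'; simp
        rw [e]
        exact .tr (ccutCF Δ₀ f g1 h1) g2
      · subst h2
        have e : ∀ Γ' : List _, ((Λ₁ ++ Δ₀') ++ Γ') ++ Δ₁ = Λ₁ ++ ((Δ₀' ++ Γ') ++ Δ₁) := by
          intro Γ'; simp
        rw [e]
        exact .tr g1 (ccutCF Δ₀' f g2 h1)
  termination_by V S Γ Λ Δ₁ A C Δ₀ f g h => (sizeOf A, sizeOf g, sizeOf f)
  decreasing_by
    all_goals subst_vars
    all_goals simp_wf
    all_goals (first
      | (apply Prod.Lex.left; first | omega | (simp; omega))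
      | (apply Prod.Lex.right; first
          | (apply Prod.Lex.left; first | omega | (simp; omega))
          | (apply Prod.Lex.right; first | omega | (simp; omega))))
end

def cmpltCF {V : Type} {A C : Fma V} : Der A C → CF (some A) [] C
  | .id => .ax
  | .comp g f => scutCF (Γ := []) (Δ := []) (cmpltCF f) (cmpltCF g)
  | .tens f g => .tl (.tr (cmpltCF f) (.uf (cmpltCF g)))
  | .lam => .tl (.Il (.uf .ax))
  | .rho => .tr .ax .Ir
  | .alpha => .tl (.tl (.tr .ax (.uf (.tr .ax (.uf .ax)))))

mutual
inductive FocL {V : Type} : Stp V → List (Fma V) → Fma V → Type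
  | uf : FocL (some A) Γ C → FocL none (A :: Γ) C
  | Il : FocL none Γ C → FocL (some Fma.unit) Γ C
  | tl : FocL (some A) (B :: Γ) C → FocL (some (Fma.tens A B)) Γ C
  | sw : FocR T Γ C → FocL T Γ C

inductive FocR {V : Type} : Stp V → List (Fma V) → Fma V → Type
  | ax : FocR (some (Fma.var X)) [] (Fma.var X)
  | Ir : FocR none [] Fma.unit
  | tr : FocR T Γ A → FocL none Δ B → FocR T (Γ ++ Δ) (Fma.tens A B)
end

def trL {V : Type} {S : Stp V} {Γ Δ : List (Fma V)} {A B : Fma V} :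
    FocL S Γ A → FocL none Δ B → FocL S (Γ ++ Δ) (Fma.tens A B)
  | .uf f, g => .uf (trL f g)
  | .Il f, g => .Il (trL f g)
  | .tl f, g => .tl (trL f g)
  | .sw f, g => .sw (.tr f g)

def axL {V : Type} : (A : Fma V) → FocL (some A) [] A
  | .var X => .sw .ax
  | .unit => .Il (.sw .Ir)
  | .tens A B => .tl (trL (axL A) (.uf (axL B)))

def focus {V : Type} {S : Stp V} {Γ : List (Fma V)} {C : Fma V} : CF S Γ C → FocL S Γ C
  | .ax => axL _
  | .uf f => .uf (focus f)
  | .Il f => .Il (focus f)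
  | .Ir => .sw .Ir
  | .tl f => .tl (focus f)
  | .tr f g => trL (focus f) (focus g)

/-- Untyped skeletons of focused derivations, with an extra element `err` for ill-typed results. -/
inductive Raw : Type
  | uf : Raw → Raw
  | Il : Raw → Raw
  | tl : Raw → Raw
  | ax : Raw
  | Ir : Raw
  | tr : Raw → Raw → Raw
  | err : Raw

namespace Raw

/-- The admissible right tensor rule on skeletons. -/
def trN : Raw → Raw → Raw
  | uf a, b => uf (trN a b)
  | Il a, b => Il (trN a b)
  | tl a, b => tl (trN a b)
  | ax, b => tr ax b
  | Ir, b => tr Ir b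
  | tr a a', b => tr (tr a a') b
  | err, _ => err

/-- Eliminate a skeleton of tensor type, letting its left rules float outside. -/
def bindT : Raw → (Raw → Raw → Raw) → Raw
  | uf a, K => uf (bindT a K)
  | Il a, K => Il (bindT a K)
  | tl a, K => tl (bindT a K)
  | tr a b, K => K a b
  | _, _ => err

/-- Eliminate a skeleton of unit type, letting its left rules float outside. -/
def bindI : Raw → Raw → Raw
  | uf a, M => uf (bindI a M)
  | Il a, M => Il (bindI a M)
  | tl a, M => tl (bindI a M)
  | Ir, M => M
  | _, _ => err

/-- The number of formulae in the context of a derivation with the given skeleton. -/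
def ctxLength : Raw → ℤ
  | uf a => ctxLength a + 1
  | Il a => ctxLength a
  | tl a => ctxLength a - 1
  | ax => 0
  | Ir => 0
  | tr a b => ctxLength a + ctxLength b
  | err => 0

/-- Maps of skeletons commuting with left rules and preserving `err`. -/
structure Linear (F : Raw → Raw) : Prop where
  uf : ∀ a, F (uf a) = Raw.uf (F a)
  Il : ∀ a, F (Il a) = Raw.Il (F a)
  tl : ∀ a, F (tl a) = Raw.tl (F a)
  err : F err = Raw.err

theorem Linear.bindT {F : Raw → Raw} (hF : Linear F) (s : Raw) (K : Raw → Raw → Raw) :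
    F (s.bindT K) = s.bindT fun a b => F (K a b) := by
  induction s <;> simp_all [Raw.bindT, hF.uf, hF.Il, hF.tl, hF.err]

theorem Linear.bindI {F : Raw → Raw} (hF : Linear F) (s M : Raw) :
    F (s.bindI M) = s.bindI (F M) := by
  induction s <;> simp_all [Raw.bindI, hF.uf, hF.Il, hF.tl, hF.err]

theorem bindT_trN (K : Raw → Raw → Raw) (a b : Raw) (hK : Linear fun a => K a b) :
    (trN a b).bindT K = K a b := by
  have h1 := hK.uf
  have h2 := hK.Il
  have h3 := hK.tl
  have h4 := hK.err
  induction a <;> simp_all [Raw.bindT, trN]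

theorem linear_trN (b : Raw) : Linear fun a => trN a b := by
  constructor <;> simp [trN]

theorem linear_bindI (M : Raw) : Linear fun a => bindI a M := by
  constructor <;> simp [Raw.bindI]

theorem linear_bindT (K : Raw → Raw → Raw) : Linear fun a => bindT a K := by
  constructor <;> simp [Raw.bindT]

theorem Linear.comp {F G : Raw → Raw} (hF : Linear F) (hG : Linear G) :
    Linear fun a => F (G a) := by
  constructor <;> simp [hF.uf, hF.Il, hF.tl, hF.err, hG.uf, hG.Il, hG.tl, hG.err]

end Raw

/-- Simultaneous substitution of skeletons for the stoup and the context of a derivation.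
The value for an empty stoup is irrelevant. -/
def CF.subst {V : Type} {S : Stp V} {Γ : List (Fma V)} {C : Fma V} :
    CF S Γ C → Raw → List Raw → Raw
  | .ax, s, _ => s
  | .uf g, _, e => g.subst (e.headD Raw.err) e.tail
  | .Il g, s, e => s.bindI (g.subst Raw.err e)
  | .Ir, _, _ => Raw.Ir
  | .tl g, s, e => s.bindT fun a b => g.subst a (b :: e)
  | .tr (Γ := Γ₁) g₁ g₂, s, e =>
      Raw.trN (g₁.subst s (e.take Γ₁.length)) (g₂.subst Raw.err (e.drop Γ₁.length))

namespace CF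

variable {V : Type}

theorem subst_stoup_irrel {S : Stp V} {Γ : List (Fma V)} {C : Fma V} (g : CF S Γ C)
    (hS : S = none) (s s' : Raw) (e : List Raw) : g.subst s e = g.subst s' e := by
  induction g generalizing s s' e with
  | ax => cases hS
  | uf g _ => rfl
  | Il g _ => cases hS
  | Ir => rfl
  | tl g _ => cases hS
  | tr g₁ g₂ ih₁ _ => simp only [subst]; rw [ih₁ hS s s']

theorem linear_subst' {S : Stp V} {Γ : List (Fma V)} {C : Fma V} (g : CF S Γ C)
    (hS : S ≠ none) (e : List Raw) : Raw.Linear fun s => g.subst s e := by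
  induction g generalizing e with
  | ax => constructor <;> simp [subst]
  | uf g _ => exact absurd rfl hS
  | Il g _ => constructor <;> simp [subst, Raw.bindI]
  | Ir => exact absurd rfl hS
  | tl g _ => constructor <;> simp [subst, Raw.bindT]
  | tr g₁ g₂ ih₁ _ =>
    have h := ih₁ hS
    constructor <;> simp [subst, (h _).uf, (h _).Il, (h _).tl, (h _).err, Raw.trN]

theorem linear_subst {A : Fma V} {Γ : List (Fma V)} {C : Fma V} (g : CF (some A) Γ C)
    (e : List Raw) : Raw.Linear fun s => g.subst s e := linear_subst' g (by simp) e

theorem subst_cast {S : Stp V} {Γ Γ' : List (Fma V)} {C : Fma V} (hΓ : Γ = Γ')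
    (h : CF S Γ' C = CF S Γ C) (g : CF S Γ C) : (Eq.mpr h g).subst = g.subst := by
  subst hΓ; rfl

theorem subst_tr {S : Stp V} {Γ Δ : List (Fma V)} {A B : Fma V} (g₁ : CF S Γ A)
    (g₂ : CF none Δ B) (s : Raw) (e₁ e₂ : List Raw) (h : e₁.length = Γ.length) :
    (tr g₁ g₂).subst s (e₁ ++ e₂) = Raw.trN (g₁.subst s e₁) (g₂.subst Raw.err e₂) := by
  simp [subst, ← h]

end CF

theorem exists_append_of_length_eq {α : Type} {l : List α} {m n : ℕ} (h : l.length = m + n) :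
    ∃ a b, l = a ++ b ∧ a.length = m ∧ b.length = n :=
  ⟨l.take m, l.drop m, by simp, by simp [h], by simp [h]⟩

mutual
theorem subst_scutCF : {V : Type} → {S : Stp V} → {Γ Δ : List (Fma V)} → {A C : Fma V} →
    (f : CF S Γ A) → (g : CF (some A) Δ C) → (s : Raw) → (e₁ e₂ : List Raw) →
    (h₁ : e₁.length = Γ.length) → (h₂ : e₂.length = Δ.length) →
    (scutCF f g).subst s (e₁ ++ e₂) = g.subst (f.subst s e₁) e₂
  | _, _, _, _, _, _, .ax, g, s, e₁, e₂, h₁, h₂ => by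
      obtain rfl : e₁ = [] := by simpa using h₁
      rw [scutCF]; rfl
  | _, _, _, _, _, _, .uf f, g, s, [], e₂, h₁, h₂ => by simp at h₁
  | _, _, _, _, _, _, .uf f, g, s, b :: e₁, e₂, h₁, h₂ => by
      rw [scutCF]
      exact subst_scutCF f g b e₁ e₂ (by simpa using h₁) h₂
  | _, _, _, _, _, _, .Il f, g, s, e₁, e₂, h₁, h₂ => by
      rw [scutCF]
      simp only [CF.subst]
      rw [(g.linear_subst e₂).bindI, subst_scutCF f g _ e₁ e₂ h₁ h₂]
  | _, _, _, _, _, _, .tl f, g, s, e₁, e₂, h₁, h₂ => by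
      rw [scutCF]
      simp only [CF.subst]
      rw [(g.linear_subst e₂).bindT]
      congr 1
      funext a b
      exact subst_scutCF f g a (b :: e₁) e₂ (by simp [h₁]) h₂
  | _, _, _, _, _, _, .Ir, .ax, s, e₁, e₂, h₁, h₂ => by
      rw [scutCF]; rfl
  | _, _, _, _, _, _, .Ir, .Il g, s, e₁, e₂, h₁, h₂ => by
      obtain rfl : e₁ = [] := by simpa using h₁
      rw [scutCF]
      exact g.subst_stoup_irrel rfl _ _ _
  | _, _, _, _, _, _, .Ir, .tr g1 g2, s, e₁, e₂, h₁, h₂ => by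
      obtain rfl : e₁ = [] := by simpa using h₁
      rw [scutCF]
      obtain ⟨a, b, rfl, ha, hb⟩ := exists_append_of_length_eq (h₂.trans List.length_append)
      have := subst_scutCF .Ir g1 s [] a rfl ha
      simp only [List.nil_append] at this
      rw [CF.subst_tr _ _ _ _ _ ha]
      refine (CF.subst_tr _ _ s a b ha).trans ?_
      rw [← this]
  | _, _, _, _, _, _, .tr f1 f2, .ax, s, e₁, e₂, h₁, h₂ => by
      obtain rfl : e₂ = [] := by simpa using h₂
      rw [scutCF, CF.subst_cast (by simp)]
      simp [CF.subst]
  | _, _, _, _, _, _, .tr (Γ := Γ₁) f1 f2, .tl g, s, e₁, e₂, h₁, h₂ => by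
      rw [scutCF]
      simp only [CF.subst]
      obtain ⟨a, b, rfl, ha, hb⟩ := exists_append_of_length_eq (h₁.trans List.length_append)
      rw [Raw.bindT_trN _ _ _ (g.linear_subst _)]
      refine (subst_ccutCF Γ₁ f2 (scutCF f1 g) rfl s a b e₂ ha hb h₂).trans ?_
      rw [subst_scutCF f1 g s a (_ :: e₂) ha (by simp [h₂])]
      simp [← ha]
  | _, _, _, _, _, _, .tr f1 f2, .tr (Γ := Δ₁) g1 g2, s, e₁, e₂, h₁, h₂ => by
      rw [scutCF, CF.subst_cast (by simp)]
      obtain ⟨a, b, rfl, ha, hb⟩ := exists_append_of_length_eq (h₂.trans List.length_append)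
      rw [← List.append_assoc, CF.subst_tr _ _ _ _ _ (by simp [h₁, ha, Nat.add_assoc]),
        subst_scutCF (.tr f1 f2) g1 s e₁ a h₁ ha, CF.subst_tr _ _ _ _ _ ha]
  termination_by V S Γ Δ A C f g => (sizeOf A, sizeOf g, sizeOf f)
  decreasing_by
    all_goals subst_vars
    all_goals simp_wf
    all_goals (first
      | (apply Prod.Lex.left; omega)
      | (apply Prod.Lex.right; first
          | (apply Prod.Lex.left; omega)
          | (apply Prod.Lex.right; omega)))

theorem subst_ccutCF : {V : Type} → {S : Stp V} → {Γ Λ Δ₁ : List (Fma V)} → {A C : Fma V} →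
    (Δ₀ : List (Fma V)) → (f : CF none Γ A) → (g : CF S Λ C) → (h : Λ = Δ₀ ++ A :: Δ₁) →
    (s : Raw) → (e₀ e₁ e₂ : List Raw) → (h₀ : e₀.length = Δ₀.length) →
    (h₁ : e₁.length = Γ.length) → (h₂ : e₂.length = Δ₁.length) →
    (ccutCF Δ₀ f g h).subst s ((e₀ ++ e₁) ++ e₂) =
      g.subst s (e₀ ++ f.subst Raw.err e₁ :: e₂)
  | _, _, _, _, _, _, _, _, _, .ax, h, s, e₀, e₁, e₂, h₀, h₁, h₂ => by simp at h
  | _, _, _, _, _, _, _, _, _, .Ir, h, s, e₀, e₁, e₂, h₀, h₁, h₂ => by simp at h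
  | _, _, _, _, _, _, _, [], f, .uf g, h, s, e₀, e₁, e₂, h₀, h₁, h₂ => by
      obtain rfl : e₀ = [] := by simpa using h₀
      rw [List.nil_append] at h
      injection h with hA hΓ
      subst hA; subst hΓ
      rw [ccutCF]
      refine (subst_scutCF f g s e₁ e₂ h₁ h₂).trans ?_
      rw [f.subst_stoup_irrel rfl s Raw.err]
      rfl
  | _, _, _, _, _, _, _, A'' :: Δ₀', f, .uf g, h, s, [], e₁, e₂, h₀, h₁, h₂ => by simp at h₀
  | _, _, _, _, _, _, _, A'' :: Δ₀', f, .uf g, h, s, b :: e₀, e₁, e₂, h₀, h₁, h₂ => by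
      rw [List.cons_append] at h
      injection h with hA hΓ
      subst hA
      have ih := subst_ccutCF Δ₀' f g hΓ b e₀ e₁ e₂ (by simpa using h₀) h₁ h₂
      subst hΓ
      rw [ccutCF]
      exact ih
  | _, _, _, _, _, _, _, Δ₀, f, .Il g, h, s, e₀, e₁, e₂, h₀, h₁, h₂ => by
      rw [ccutCF]
      simp only [CF.subst]
      rw [subst_ccutCF Δ₀ f g h _ e₀ e₁ e₂ h₀ h₁ h₂]
  | _, _, _, _, _, _, _, Δ₀, f, .tl (B := B) g, h, s, e₀, e₁, e₂, h₀, h₁, h₂ => by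
      rw [ccutCF]
      simp only [CF.subst]
      congr 1
      funext a b
      exact subst_ccutCF (B :: Δ₀) f g (by simp [h]) a (b :: e₀) e₁ e₂ (by simp [h₀]) h₁ h₂
  | _, _, _, _, Δ₁, _, _, Δ₀, f, .tr (Γ := Λ₁) (Δ := Λ₂) g1 g2, h, s, e₀, e₁, e₂, h₀, h₁, h₂ => by
      rw [ccutCF]
      generalize splitList Λ₁ Λ₂ Δ₀ _ _ h = z
      rcases z with ⟨Δ₁', k1, k2⟩ | ⟨Δ₀', k1, k2⟩
      · subst k2
        dsimp only
        rw [CF.subst_cast (by simp)]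
        obtain ⟨a, b, rfl, ha, hb⟩ := exists_append_of_length_eq (h₂.trans List.length_append)
        rw [← List.append_assoc, CF.subst_tr _ _ _ _ _ (by simp [h₀, h₁, ha]),
          subst_ccutCF Δ₀ f g1 k1 s e₀ e₁ a h₀ h₁ ha, ← List.cons_append, ← List.append_assoc,
          CF.subst_tr _ _ _ _ _ (by simp [k1, h₀, ha])]
      · subst k2
        dsimp only
        rw [CF.subst_cast (by simp)]
        obtain ⟨a, b, rfl, ha, hb⟩ := exists_append_of_length_eq (h₀.trans List.length_append)
        have key := subst_ccutCF Δ₀' f g2 k1 Raw.err b e₁ e₂ hb h₁ h₂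
        simp only [List.append_assoc] at key ⊢
        rw [CF.subst_tr _ _ _ _ _ ha, CF.subst_tr _ _ _ _ _ ha, ← key]
  termination_by V S Γ Λ Δ₁ A C Δ₀ f g h => (sizeOf A, sizeOf g, sizeOf f)
  decreasing_by
    all_goals subst_vars
    all_goals simp_wf
    all_goals (first
      | (apply Prod.Lex.left; omega)
      | (apply Prod.Lex.right; apply Prod.Lex.left; omega))
end

mutual
/-- The skeleton of a derivation in phase `L`. -/
def FocL.skel {V : Type} {S : Stp V} {Γ : List (Fma V)} {C : Fma V} : FocL S Γ C → Raw
  | .uf f => .uf f.skel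
  | .Il f => .Il f.skel
  | .tl f => .tl f.skel
  | .sw f => f.skel

/-- The skeleton of a derivation in phase `R`. -/
def FocR.skel {V : Type} {S : Stp V} {Γ : List (Fma V)} {C : Fma V} : FocR S Γ C → Raw
  | .ax => .ax
  | .Ir => .Ir
  | .tr f g => .tr f.skel g.skel
end

theorem FocR.skel_cases {V : Type} {S : Stp V} {Γ : List (Fma V)} {C : Fma V} (f : FocR S Γ C) :
    f.skel = .ax ∨ f.skel = .Ir ∨ ∃ a b, f.skel = .tr a b := by
  cases f <;> simp [FocR.skel]

mutual
theorem FocL.ctxLength_skel {V : Type} {S : Stp V} {Γ : List (Fma V)} {C : Fma V} :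
    (f : FocL S Γ C) → f.skel.ctxLength = Γ.length
  | .uf f => by simp [FocL.skel, Raw.ctxLength, f.ctxLength_skel]
  | .Il f => by simp [FocL.skel, Raw.ctxLength, f.ctxLength_skel]
  | .tl f => by simp [FocL.skel, Raw.ctxLength, f.ctxLength_skel]
  | .sw f => by simp [FocL.skel, f.ctxLength_skel]

theorem FocR.ctxLength_skel {V : Type} {S : Stp V} {Γ : List (Fma V)} {C : Fma V} :
    (f : FocR S Γ C) → f.skel.ctxLength = Γ.length
  | .ax => rfl
  | .Ir => rfl
  | .tr f g => by simp [FocR.skel, Raw.ctxLength, f.ctxLength_skel, g.ctxLength_skel]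
end

mutual
theorem FocL.skel_injective {V : Type} {S : Stp V} {Γ : List (Fma V)} {C : Fma V} :
    (f g : FocL S Γ C) → f.skel = g.skel → f = g
  | .uf f, .uf g, h => by rw [f.skel_injective g (by simpa [FocL.skel] using h)]
  | .Il f, .Il g, h => by rw [f.skel_injective g (by simpa [FocL.skel] using h)]
  | .tl f, .tl g, h => by rw [f.skel_injective g (by simpa [FocL.skel] using h)]
  | .sw f, .sw g, h => by rw [eq_of_heq (f.skel_injective g rfl (by simpa [FocL.skel] using h))]
  | .sw f, .uf g, h | .sw f, .Il g, h | .sw f, .tl g, h => by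
      rcases f.skel_cases with k | k | ⟨a, b, k⟩ <;> simp [FocL.skel, k] at h
  | .uf f, .sw g, h | .Il f, .sw g, h | .tl f, .sw g, h => by
      rcases g.skel_cases with k | k | ⟨a, b, k⟩ <;> simp [FocL.skel, k] at h

theorem FocR.skel_injective {V : Type} {S : Stp V} {Γ Γ' : List (Fma V)} {C : Fma V} :
    (f : FocR S Γ C) → (g : FocR S Γ' C) → Γ = Γ' → f.skel = g.skel → HEq f g
  | .ax, g, hΓ, h => by cases g; rfl
  | .Ir, g, hΓ, h => by cases g; rfl
  | .tr f f', .tr g g', hΓ, h => by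
      rw [FocR.skel, FocR.skel] at h
      injection h with h₁ h₂
      have hl : (_ : ℤ) = _ := congrArg Raw.ctxLength h₁
      rw [f.ctxLength_skel, g.ctxLength_skel] at hl
      obtain ⟨rfl, rfl⟩ := List.append_inj hΓ (by exact_mod_cast hl)
      rw [eq_of_heq (f.skel_injective g rfl h₁), f'.skel_injective g' h₂]
end

/-- The skeleton of the focused identity derivation. -/
abbrev idSkel {V : Type} (A : Fma V) : Raw := (axL A).skel

section

variable {V : Type}

theorem trN_skel {S : Stp V} {Γ : List (Fma V)} {C : Fma V} (f : FocR S Γ C) (b : Raw) :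
    Raw.trN f.skel b = Raw.tr f.skel b := by
  cases f <;> rfl

theorem skel_trL {S : Stp V} {Γ Δ : List (Fma V)} {A B : Fma V} (f : FocL S Γ A)
    (g : FocL none Δ B) : (trL f g).skel = Raw.trN f.skel g.skel := by
  match f with
  | .uf f => simp [trL, FocL.skel, Raw.trN, skel_trL f g]
  | .Il f => simp [trL, FocL.skel, Raw.trN, skel_trL f g]
  | .tl f => simp [trL, FocL.skel, Raw.trN, skel_trL f g]
  | .sw f => simp [trL, FocL.skel, FocR.skel, trN_skel]

theorem idSkel_unit : idSkel (Fma.unit (V := V)) = .Il .Ir := rfl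

theorem idSkel_tens (A B : Fma V) :
    idSkel (A.tens B) = .tl (Raw.trN (idSkel A) (.uf (idSkel B))) := by
  simp [idSkel, axL, FocL.skel, skel_trL]

theorem skel_focus {S : Stp V} {Γ : List (Fma V)} {C : Fma V} (g : CF S Γ C) :
    (focus g).skel = g.subst (S.elim Raw.err idSkel) (Γ.map fun A => Raw.uf (idSkel A)) := by
  induction g with
  | ax => rfl
  | uf g ih => simp [focus, FocL.skel, CF.subst, ih, (g.linear_subst _).uf]
  | Il g ih => simp [focus, FocL.skel, CF.subst, ih, idSkel_unit, Raw.bindI]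
  | Ir => rfl
  | tl g ih =>
    simp only [focus, FocL.skel, CF.subst, ih, Option.elim, List.map_cons, idSkel_tens, Raw.bindT]
    rw [Raw.bindT_trN (fun a b => g.subst a (b :: _)) _ _ (g.linear_subst _)]
  | tr g₁ g₂ ih₁ ih₂ =>
    simp [focus, CF.subst_tr, skel_trL, ih₁, ih₂]

/-- The action of a categorical derivation on skeletons by postcomposition. -/
def Der.act {A C : Fma V} (f : Der A C) (r : Raw) : Raw := (cmpltCF f).subst r []

namespace Der

variable {A B C D : Fma V}

theorem linear_act (f : Der A C) : Raw.Linear f.act := (cmpltCF f).linear_subst []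

theorem skel_focus_cmpltCF (f : Der A C) : (focus (cmpltCF f)).skel = f.act (idSkel A) :=
  skel_focus _

@[simp] theorem act_id (r : Raw) : (Der.id (A := A)).act r = r := rfl

@[simp] theorem act_comp (g : Der B C) (f : Der A B) (r : Raw) :
    (Der.comp g f).act r = g.act (f.act r) :=
  subst_scutCF (cmpltCF f) (cmpltCF g) r [] [] rfl rfl

@[simp] theorem act_tens (f : Der A C) (g : Der B D) (a b : Raw) :
    (Der.tens f g).act (Raw.trN a b) = Raw.trN (f.act a) (g.act b) :=
  Raw.bindT_trN _ _ _ ((Raw.linear_trN _).comp f.linear_act)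

@[simp] theorem act_lam (a b : Raw) :
    (Der.lam (A := A)).act (Raw.trN a b) = a.bindI b :=
  Raw.bindT_trN _ _ _ (Raw.linear_bindI b)

@[simp] theorem act_rho (r : Raw) : (Der.rho (A := A)).act r = Raw.trN r Raw.Ir := rfl

@[simp] theorem act_alpha (a b c : Raw) :
    (Der.alpha (A := A) (B := B) (C := C)).act (Raw.trN (Raw.trN a b) c) =
      Raw.trN a (Raw.trN b c) :=
  (Raw.bindT_trN _ _ _ (Raw.linear_bindT _)).trans (Raw.bindT_trN _ _ _ (Raw.linear_trN _))

end Der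

end

open CategoryTheory

/-- Categorical derivations up to equality. -/
instance Der.setoid {V : Type} (A C : Fma V) : Setoid (Der A C) :=
  ⟨DerEq, fun _ => .refl, .symm, .trans⟩

/-- The free skew monoidal category. -/
instance Fma.category {V : Type} : SmallCategory (Fma V) where
  Hom A C := Quotient (Der.setoid A C)
  id _ := ⟦.id⟧
  comp f g := Quotient.map₂ (fun f g => .comp g f) (fun _ _ h _ _ k => .compCong k h) f g
  id_comp f := Quotient.inductionOn f fun _ => Quotient.sound .compIdR
  comp_id f := Quotient.inductionOn f fun _ => Quotient.sound .compIdL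
  assoc f g h := Quotient.inductionOn₃ f g h fun _ _ _ => Quotient.sound .compAssoc

/-- The map of the free skew monoidal category given by a derivation. -/
def Der.hom {V : Type} {A C : Fma V} (f : Der A C) : A ⟶ C := Quotient.mk _ f

namespace Fsk

variable {V : Type} {A A' B B' C C' D : Fma V}

/-- The tensor product of maps. -/
def tens (f : A ⟶ A') (g : B ⟶ B') : A.tens B ⟶ A'.tens B' :=
  Quotient.map₂ Der.tens (fun _ _ h _ _ k => .tensCong h k) f g

/-- The left unitor. -/
def lam (A : Fma V) : Fma.unit.tens A ⟶ A := Der.lam.hom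

/-- The right unitor. -/
def rho (A : Fma V) : A ⟶ A.tens Fma.unit := Der.rho.hom

/-- The associator. -/
def alpha (A B C : Fma V) : (A.tens B).tens C ⟶ A.tens (B.tens C) := Der.alpha.hom

theorem tens_id : tens (𝟙 A) (𝟙 B) = 𝟙 _ := Quotient.sound .tensId

theorem tens_comp {A'' B'' : Fma V} (f : A ⟶ A') (f' : A' ⟶ A'') (g : B ⟶ B') (g' : B' ⟶ B'') :
    tens f g ≫ tens f' g' = tens (f ≫ f') (g ≫ g') :=
  Quotient.inductionOn₂ f f' (fun _ _ => Quotient.inductionOn₂ g g' fun _ _ =>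
    Quotient.sound (.symm .tensComp))

theorem lam_naturality (f : A ⟶ B) : tens (𝟙 _) f ≫ lam B = lam A ≫ f :=
  Quotient.inductionOn f fun _ => Quotient.sound (.symm .natLam)

theorem rho_naturality (f : A ⟶ B) : f ≫ rho B = rho A ≫ tens f (𝟙 _) :=
  Quotient.inductionOn f fun _ => Quotient.sound .natRho

theorem alpha_naturality (f : A ⟶ A') (g : B ⟶ B') (h : C ⟶ C') :
    tens (tens f g) h ≫ alpha A' B' C' = alpha A B C ≫ tens f (tens g h) :=
  Quotient.inductionOn₃ f g h fun _ _ _ => Quotient.sound .natAlpha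

theorem rho_lam : rho Fma.unit ≫ lam Fma.unit = 𝟙 (Fma.unit : Fma V) := Quotient.sound .lamRho

theorem rho_alpha_lam :
    (tens (rho A) (𝟙 B) ≫ alpha A Fma.unit B) ≫ tens (𝟙 A) (lam B) = 𝟙 _ :=
  Quotient.sound .skewB

theorem alpha_lam : alpha Fma.unit A B ≫ lam _ = tens (lam A) (𝟙 B) := Quotient.sound .skewC

theorem rho_alpha : rho (A.tens B) ≫ alpha A B _ = tens (𝟙 A) (rho B) := Quotient.sound .skewD

theorem alpha_pentagon :
    (tens (alpha A B C) (𝟙 D) ≫ alpha A (B.tens C) D) ≫ tens (𝟙 A) (alpha B C D) =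
      alpha (A.tens B) C D ≫ alpha A B (C.tens D) := Quotient.sound .skewE

/-- Functoriality of `semF` in its first argument. -/
def map : {A B : Fma V} → (f : A ⟶ B) → (Γ : List (Fma V)) → (semF A Γ ⟶ semF B Γ)
  | _, _, f, [] => f
  | _, _, f, C :: Γ => map (tens f (𝟙 C)) Γ

/-- Move the first tensor factor out of a left-bracketed product. -/
def psi : (A B : Fma V) → (Δ : List (Fma V)) → (semF (A.tens B) Δ ⟶ A.tens (semF B Δ))
  | _, _, [] => 𝟙 _
  | A, B, C :: Δ => map (alpha A B C) Δ ≫ psi A (B.tens C) Δ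

/-- Split a left-bracketed product in two. -/
def phi : (A : Fma V) → (Γ Δ : List (Fma V)) →
    (semF A (Γ ++ Δ) ⟶ (semF A Γ).tens (semF Fma.unit Δ))
  | A, [], Δ => map (rho A) Δ ≫ psi A Fma.unit Δ
  | A, C :: Γ, Δ => phi (A.tens C) Γ Δ

theorem map_id (A : Fma V) (Γ : List (Fma V)) : map (𝟙 A) Γ = 𝟙 _ := by
  induction Γ generalizing A with
  | nil => rfl
  | cons C Γ ih => rw [map, tens_id]; exact ih _

theorem map_comp (f : A ⟶ B) (g : B ⟶ C) (Γ : List (Fma V)) :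
    map f Γ ≫ map g Γ = map (f ≫ g) Γ := by
  induction Γ generalizing A B C with
  | nil => rfl
  | cons X Γ ih =>
    refine (ih _ _).trans ?_
    rw [tens_comp, Category.comp_id]; rfl

theorem map_comp_assoc (f : A ⟶ B) (g : B ⟶ C) (Γ : List (Fma V)) (h : semF C Γ ⟶ D) :
    map f Γ ≫ map g Γ ≫ h = map (f ≫ g) Γ ≫ h := by
  rw [← Category.assoc, map_comp]

theorem psi_naturality_left (f : A ⟶ A') (B : Fma V) (Δ : List (Fma V)) :
    map (tens f (𝟙 B)) Δ ≫ psi A' B Δ = psi A B Δ ≫ tens f (𝟙 _) := by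
  induction Δ generalizing B with
  | nil => simp [psi, map, semF]
  | cons C Δ ih =>
    dsimp only [psi, map, semF]
    rw [Category.assoc, ← ih, map_comp_assoc, map_comp_assoc, alpha_naturality, tens_id]

theorem psi_naturality_right (A : Fma V) (g : B ⟶ B') (Δ : List (Fma V)) :
    map (tens (𝟙 A) g) Δ ≫ psi A B' Δ = psi A B Δ ≫ tens (𝟙 A) (map g Δ) := by
  induction Δ generalizing B B' with
  | nil => simp [psi, map, semF]
  | cons C Δ ih =>
    dsimp only [psi, map, semF]
    rw [Category.assoc, ← ih, map_comp_assoc, map_comp_assoc, alpha_naturality]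

theorem psi_naturality_right_assoc (A : Fma V) (g : B ⟶ B') (Δ : List (Fma V))
    (h : A.tens (semF B' Δ) ⟶ D) :
    map (tens (𝟙 A) g) Δ ≫ psi A B' Δ ≫ h = psi A B Δ ≫ tens (𝟙 A) (map g Δ) ≫ h := by
  rw [← Category.assoc, psi_naturality_right, Category.assoc]

theorem phi_naturality (f : A ⟶ A') (Γ Δ : List (Fma V)) :
    map f (Γ ++ Δ) ≫ phi A' Γ Δ = phi A Γ Δ ≫ tens (map f Γ) (𝟙 _) := by
  induction Γ generalizing A A' with
  | nil =>
    dsimp only [phi, map, List.nil_append, semF]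
    rw [Category.assoc, ← psi_naturality_left, map_comp_assoc, map_comp_assoc, rho_naturality]
  | cons C Γ ih => exact ih _

theorem phi_naturality_assoc (f : A ⟶ A') (Γ Δ : List (Fma V))
    (h : (semF A' Γ).tens (semF Fma.unit Δ) ⟶ D) :
    map f (Γ ++ Δ) ≫ phi A' Γ Δ ≫ h = phi A Γ Δ ≫ tens (map f Γ) (𝟙 _) ≫ h := by
  rw [← Category.assoc, phi_naturality, Category.assoc]

theorem psi_lam (B : Fma V) (Δ : List (Fma V)) : psi Fma.unit B Δ ≫ lam _ = map (lam B) Δ := by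
  induction Δ generalizing B with
  | nil => exact Category.id_comp _
  | cons C Δ ih =>
    dsimp only [psi, map, semF]
    rw [Category.assoc, ih, map_comp, alpha_lam]

theorem psi_alpha (A B D : Fma V) (Γ : List (Fma V)) :
    psi (A.tens B) D Γ ≫ alpha A B _ =
      map (alpha A B D) Γ ≫ psi A (B.tens D) Γ ≫ tens (𝟙 A) (psi B D Γ) := by
  induction Γ generalizing D with
  | nil => simp [psi, map, semF, tens_id]
  | cons C Γ ih =>
    have h := tens_comp (𝟙 A) (𝟙 A) (map (alpha B D C) Γ) (psi B (D.tens C) Γ)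
    rw [Category.comp_id] at h
    dsimp only [psi, map, semF]
    rw [Category.assoc, ih, ← h, Category.assoc, ← psi_naturality_right_assoc]
    simp only [map_comp_assoc, ← alpha_pentagon, Category.assoc]

theorem psi_phi (A B : Fma V) (Γ Δ : List (Fma V)) :
    phi (A.tens B) Γ Δ ≫ tens (psi A B Γ) (𝟙 _) ≫ alpha _ _ _ =
      psi A B (Γ ++ Δ) ≫ tens (𝟙 A) (phi B Γ Δ) := by
  induction Γ generalizing B with
  | nil =>
    have h := tens_comp (𝟙 A) (𝟙 A) (map (rho B) Δ) (psi B Fma.unit Δ)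
    rw [Category.comp_id] at h
    dsimp only [phi, psi, List.nil_append, semF]
    rw [tens_id, Category.id_comp, ← h, ← psi_naturality_right_assoc, ← rho_alpha, ← map_comp,
      Category.assoc, psi_alpha, Category.assoc]
  | cons C Γ ih =>
    have h := tens_comp (map (alpha A B C) Γ) (psi A (B.tens C) Γ) (𝟙 _) (𝟙 (semF Fma.unit Δ))
    rw [Category.comp_id] at h
    dsimp only [phi, psi, List.cons_append, semF]
    rw [Category.assoc, ← ih, phi_naturality_assoc, ← h, Category.assoc]

theorem phi_alpha (A : Fma V) (Γ₁ Γ₂ Γ₃ : List (Fma V)) :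
    phi A (Γ₁ ++ Γ₂) Γ₃ ≫ tens (phi A Γ₁ Γ₂) (𝟙 _) ≫ alpha _ _ _ =
      eqToHom (by rw [List.append_assoc]) ≫ phi A Γ₁ (Γ₂ ++ Γ₃) ≫
        tens (𝟙 _) (phi Fma.unit Γ₂ Γ₃) := by
  induction Γ₁ generalizing A with
  | nil =>
    have h := tens_comp (map (rho A) Γ₂) (psi A Fma.unit Γ₂) (𝟙 _) (𝟙 (semF Fma.unit Γ₃))
    rw [Category.comp_id] at h
    dsimp only [phi, psi, List.nil_append, semF, eqToHom_refl]
    rw [Category.id_comp, ← h, Category.assoc, ← phi_naturality_assoc, psi_phi, Category.assoc]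
  | cons C Γ ih => exact ih _

theorem phi_nil (A : Fma V) (Γ : List (Fma V)) :
    phi A Γ [] = eqToHom (by rw [List.append_nil]) ≫ rho (semF A Γ) := by
  induction Γ generalizing A with
  | nil => exact (Category.comp_id _).trans (Category.id_comp _).symm
  | cons C Γ ih => exact ih _

theorem phi_tens_lam {Δ : List (Fma V)} (k : semF Fma.unit Δ ⟶ C) :
    (phi Fma.unit [] Δ ≫ tens (𝟙 Fma.unit) k) ≫ lam C = k := by
  dsimp only [phi, semF, List.nil_append]
  rw [Category.assoc, lam_naturality, Category.assoc, ← Category.assoc (psi _ _ _), psi_lam,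
    map_comp_assoc, rho_lam, map_id, Category.id_comp]

theorem phi_tens_rho {Γ : List (Fma V)} (d : semF A Γ ⟶ C) :
    phi A Γ [] ≫ tens d (𝟙 Fma.unit) = eqToHom (by rw [List.append_nil]) ≫ d ≫ rho C := by
  rw [phi_nil, rho_naturality d]
  exact Category.assoc (eqToHom _) (rho (semF A Γ)) (tens d (𝟙 Fma.unit))

theorem phi_tens_alpha {Γ₁ Γ₂ Γ₃ : List (Fma V)} (f : semF D Γ₁ ⟶ A)
    (g : semF Fma.unit Γ₂ ⟶ B) (h : semF Fma.unit Γ₃ ⟶ C) :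
    phi D Γ₁ (Γ₂ ++ Γ₃) ≫ tens f (phi Fma.unit Γ₂ Γ₃ ≫ tens g h) =
      eqToHom (by rw [List.append_assoc]) ≫
        (phi D (Γ₁ ++ Γ₂) Γ₃ ≫ tens (phi D Γ₁ Γ₂ ≫ tens f g) h) ≫ alpha A B C := by
  have h₁ := tens_comp (phi D Γ₁ Γ₂) (tens f g) (𝟙 _) h
  have h₂ := tens_comp (𝟙 _) f (phi Fma.unit Γ₂ Γ₃) (tens g h)
  rw [Category.id_comp] at h₁ h₂
  have h₃ := congrArg (· ≫ tens f (tens g h)) (phi_alpha D Γ₁ Γ₂ Γ₃)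
  simp only [Category.assoc] at h₃
  rw [← h₁, ← h₂]
  simp only [Category.assoc]
  rw [alpha_naturality, h₃]
  simp

end Fsk

mutual
/-- The interpretation of phase `L` derivations in the free skew monoidal category. -/
def FocL.hom {V : Type} {S : Stp V} {Γ : List (Fma V)} {C : Fma V} :
    FocL S Γ C → (semF (stpF S) Γ ⟶ C)
  | .uf (A := A) (Γ := Γ) f => Fsk.map (Fsk.lam A) Γ ≫ f.hom
  | .Il f => f.hom
  | .tl f => f.hom
  | .sw f => f.hom

/-- The interpretation of phase `R` derivations in the free skew monoidal category. -/
def FocR.hom {V : Type} {S : Stp V} {Γ : List (Fma V)} {C : Fma V} :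
    FocR S Γ C → (semF (stpF S) Γ ⟶ C)
  | .ax => 𝟙 _
  | .Ir => 𝟙 _
  | .tr (Γ := Γ) (Δ := Δ) f g => Fsk.phi _ Γ Δ ≫ Fsk.tens f.hom g.hom
end

section

variable {V : Type}

theorem FocR.skel_tr {S : Stp V} {Γ Δ : List (Fma V)} {A B : Fma V} (f : FocR S Γ A)
    (g : FocL none Δ B) : (f.tr g).skel = Raw.trN f.skel g.skel := (trN_skel f _).symm

theorem hom_trL {S : Stp V} {Γ Δ : List (Fma V)} {A B : Fma V} (f : FocL S Γ A)
    (g : FocL none Δ B) :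
    (trL f g).hom = Fsk.phi (stpF S) Γ Δ ≫ Fsk.tens f.hom g.hom := by
  match f with
  | .uf (A := A) (Γ := Γ) f =>
    have h := Fsk.tens_comp (Fsk.map (Fsk.lam A) Γ) f.hom (𝟙 _) g.hom
    rw [Category.id_comp] at h
    dsimp only [trL, FocL.hom, stpF, List.cons_append, semF, Fsk.phi] at h ⊢
    rw [hom_trL f g, ← h, ← Fsk.phi_naturality_assoc]
    rfl
  | .Il f => exact hom_trL f g
  | .tl f => exact hom_trL f g
  | .sw f => rfl

theorem hom_axL (A : Fma V) : (axL A).hom = 𝟙 A := by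
  induction A with
  | var X => rfl
  | unit => rfl
  | tens A B ihA ihB =>
    refine (hom_trL (axL A) (.uf (axL B))).trans ?_
    have hB : (FocL.uf (axL B)).hom = Fsk.lam B := by
      rw [FocL.hom, ihB]; exact Category.comp_id _
    rw [ihA, hB, ← Fsk.rho_alpha_lam]
    refine congrArg (· ≫ _) ?_
    dsimp only [Fsk.phi, Fsk.psi, Fsk.map, semF]
    exact congrArg _ (Category.comp_id _)

/-- `Denotes r S Γ C d` holds if some focused derivation of `S ∣ Γ ⟶ C` has skeleton `r` and
interpretation `d`. -/
def Denotes (r : Raw) (S : Stp V) (Γ : List (Fma V)) (C : Fma V)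
    (d : semF (stpF S) Γ ⟶ C) : Prop :=
  ∃ f : FocL S Γ C, f.skel = r ∧ f.hom = d

namespace Denotes

theorem trN {S : Stp V} {Γ Δ : List (Fma V)} {A B : Fma V} {r r' : Raw}
    {d : semF (stpF S) Γ ⟶ A} {d' : semF (stpF none) Δ ⟶ B}
    (h : Denotes r S Γ A d) (h' : Denotes r' none Δ B d') :
    Denotes (Raw.trN r r') S (Γ ++ Δ) (A.tens B)
      (Fsk.phi (stpF S) Γ Δ ≫ Fsk.tens d d') := by
  obtain ⟨f, rfl, rfl⟩ := h
  obtain ⟨g, rfl, rfl⟩ := h'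
  exact ⟨trL f g, skel_trL f g, hom_trL f g⟩

theorem of_eqToHom {S : Stp V} {Γ Γ' : List (Fma V)} {A : Fma V} {r : Raw}
    {d : semF (stpF S) Γ ⟶ A} (h : Denotes r S Γ A d) (hΓ : Γ = Γ')
    {d' : semF (stpF S) Γ' ⟶ A} (hd : d = eqToHom (by rw [hΓ]) ≫ d') :
    Denotes r S Γ' A d' := by
  subst hΓ
  rw [eqToHom_refl, Category.id_comp] at hd
  exact hd ▸ h

/-- A linear map of skeletons is postcomposition by `k` if it is so in phase `R`. -/
theorem of_phaseR {F : Raw → Raw} (hF : Raw.Linear F) {A C : Fma V} (k : A ⟶ C)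
    (h : ∀ {S : Stp V} {Γ : List (Fma V)} (f : FocR S Γ A),
      Denotes (F f.skel) S Γ C (f.hom ≫ k))
    {S : Stp V} {Γ : List (Fma V)} (f : FocL S Γ A) :
    Denotes (F f.skel) S Γ C (f.hom ≫ k) := by
  match f with
  | .uf f =>
    obtain ⟨g, h₁, h₂⟩ := of_phaseR hF k h f
    refine ⟨.uf g, by simp [FocL.skel, hF.uf, h₁], ?_⟩
    rw [FocL.hom, FocL.hom, h₂]
    exact (Category.assoc _ _ _).symm
  | .Il f =>
    obtain ⟨g, h₁, h₂⟩ := of_phaseR hF k h f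
    exact ⟨.Il g, by simp [FocL.skel, hF.Il, h₁], h₂⟩
  | .tl f =>
    obtain ⟨g, h₁, h₂⟩ := of_phaseR hF k h f
    exact ⟨.tl g, by simp [FocL.skel, hF.tl, h₁], h₂⟩
  | .sw f => exact h f

theorem act {A C : Fma V} (k : Der A C) {S : Stp V} {Γ : List (Fma V)} {r : Raw}
    {d : semF (stpF S) Γ ⟶ A} (h : Denotes r S Γ A d) :
    Denotes (k.act r) S Γ C (d ≫ k.hom) := by
  induction k generalizing S Γ r with
  | id => exact (Category.comp_id d).symm ▸ h
  | comp g f ihg ihf =>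
    rw [Der.act_comp]
    exact (Category.assoc d f.hom g.hom) ▸ ihg (ihf h)
  | tens f g ihf ihg =>
    obtain ⟨x, rfl, rfl⟩ := h
    refine of_phaseR (Der.linear_act _) _ (fun x => ?_) x
    cases x with
    | tr x y =>
      have := (ihf ⟨.sw x, rfl, rfl⟩).trN (ihg ⟨y, rfl, rfl⟩)
      refine this.of_eqToHom rfl ?_
      rw [eqToHom_refl, Category.id_comp]
      exact (congrArg _ (Fsk.tens_comp _ _ _ _).symm).trans (Category.assoc _ _ _).symm
  | @lam A =>
    obtain ⟨x, rfl, rfl⟩ := h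
    refine of_phaseR (Der.linear_act _) _ (fun x => ?_) x
    cases x with
    | @tr _ _ _ Δ _ x y =>
      cases x
      exact ⟨y, rfl, (Fsk.phi_tens_lam y.hom).symm⟩
  | @rho A =>
    have := h.trN ⟨.sw .Ir, rfl, rfl⟩
    exact this.of_eqToHom (List.append_nil Γ) (Fsk.phi_tens_rho d)
  | @alpha A B C =>
    obtain ⟨x, rfl, rfl⟩ := h
    refine of_phaseR (Der.linear_act _) _ (fun x => ?_) x
    cases x with
    | @tr _ _ _ Γ₃ _ x z =>
      cases x with
      | @tr S Γ₁ _ Γ₂ _ x y =>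
        have hr : (Der.alpha (A := A) (B := B) (C := C)).act ((x.tr y).tr z).skel =
            Raw.trN x.skel (Raw.trN y.skel z.skel) := by
          rw [FocR.skel_tr, FocR.skel_tr, Der.act_alpha]
        rw [hr]
        have := Denotes.trN ⟨.sw x, rfl, rfl⟩ (Denotes.trN ⟨y, rfl, rfl⟩ ⟨z, rfl, rfl⟩)
        exact this.of_eqToHom (List.append_assoc _ _ _).symm
          (Fsk.phi_tens_alpha x.hom y.hom z.hom)

end Denotes

theorem Der.hom_focus_cmpltCF {A C : Fma V} (f : Der A C) : (focus (cmpltCF f)).hom = f.hom := by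
  obtain ⟨x, h₁, h₂⟩ := Denotes.act f ⟨axL A, rfl, hom_axL A⟩
  rw [← f.skel_focus_cmpltCF] at h₁
  rw [← FocL.skel_injective _ _ h₁, h₂]
  exact Category.id_comp _

theorem exists_skel_eq_act {A C : Fma V} (k : Der A C) {S : Stp V} {Γ : List (Fma V)}
    (f : FocL S Γ A) : ∃ g : FocL S Γ C, g.skel = k.act f.skel :=
  let ⟨g, h, _⟩ := Denotes.act k ⟨f, rfl, rfl⟩
  ⟨g, h⟩

theorem Raw.Linear.congr {F G : Raw → Raw} (hF : Linear F) (hG : Linear G) {A : Fma V}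
    (h : ∀ {S : Stp V} {Γ : List (Fma V)} (f : FocR S Γ A), F f.skel = G f.skel)
    {S : Stp V} {Γ : List (Fma V)} (f : FocL S Γ A) : F f.skel = G f.skel := by
  match f with
  | .uf f => simp [FocL.skel, hF.uf, hG.uf, congr hF hG h f]
  | .Il f => simp [FocL.skel, hF.Il, hG.Il, congr hF hG h f]
  | .tl f => simp [FocL.skel, hF.tl, hG.tl, congr hF hG h f]
  | .sw f => exact h f

theorem DerEq.act_eq {A C : Fma V} {f g : Der A C} (h : DerEq f g) {S : Stp V}
    {Γ : List (Fma V)} (x : FocL S Γ A) : f.act x.skel = g.act x.skel := by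
  induction h generalizing S Γ with
  | refl => rfl
  | symm _ ih => exact (ih x).symm
  | trans _ _ ih₁ ih₂ => exact (ih₁ x).trans (ih₂ x)
  | @compCong B C g g' A f f' _ _ ihg ihf =>
    obtain ⟨y, hy⟩ := exists_skel_eq_act f' x
    rw [Der.act_comp, Der.act_comp, ihf, ← hy, ihg]
  | tensCong _ _ ihf ihg =>
    refine Raw.Linear.congr (Der.linear_act _) (Der.linear_act _) (fun x => ?_) x
    cases x with
    | tr x y =>
      have := ihf (.sw x)
      simp_all [FocR.skel_tr, FocL.skel]
  | compIdL => simp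
  | compIdR => simp
  | compAssoc => simp
  | natRho => simp
  | tensId | tensComp | skewB | skewD =>
    refine Raw.Linear.congr (Der.linear_act _) (Der.linear_act _) (fun x => ?_) x
    cases x
    simp [FocR.skel_tr, Raw.bindI]
  | natLam =>
    refine Raw.Linear.congr (Der.linear_act _) (Der.linear_act _) (fun x => ?_) x
    cases x with
    | tr x y =>
      simp only [FocR.skel_tr]
      cases x
      simp [FocR.skel, Raw.bindI]
  | natAlpha =>
    refine Raw.Linear.congr (Der.linear_act _) (Der.linear_act _) (fun x => ?_) x
    cases x with
    | tr x y =>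
      cases x
      simp [FocR.skel_tr]
  | skewE =>
    refine Raw.Linear.congr (Der.linear_act _) (Der.linear_act _) (fun x => ?_) x
    cases x with
    | tr x y =>
      cases x with
      | tr x z =>
        cases x
        simp [FocR.skel_tr]
  | skewC =>
    refine Raw.Linear.congr (Der.linear_act _) (Der.linear_act _) (fun x => ?_) x
    cases x with
    | tr x y =>
      cases x with
      | tr x z =>
        simp only [FocR.skel_tr]
        cases x
        simp [FocR.skel, Raw.bindI]
  | lamRho =>
    refine Raw.Linear.congr (Der.linear_act _) (Der.linear_act _) (fun x => ?_) x
    cases x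
    simp [FocR.skel, Raw.bindI]

end

/-- Coherence for the free skew monoidal category: `f ≐ g` iff
`focus (cmplt f) = focus (cmplt g)`. -/
theorem statement19 (V : Type) (A C : Fma V) (f g : Der A C) :
    DerEq f g ↔ focus (cmpltCF f) = focus (cmpltCF g) := by
  constructor
  · intro h
    apply FocL.skel_injective
    rw [f.skel_focus_cmpltCF, g.skel_focus_cmpltCF, h.act_eq]
  · intro h
    have : f.hom = g.hom := by rw [← f.hom_focus_cmpltCF, h, g.hom_focus_cmpltCF]
    exact Quotient.exact this
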